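/- Let Ω ⊆ ℝⁿ be convex, p ∈ (0,1] and α, β > 0. Then every rescaled dipole (δ_x − δ_y)/(β + |x−y|^p) with x, y ∈ Ω and 0 < |x−y|^p < 2α − β is an extremal point of the set { μ ∈ M(Ω) : ‖μ‖_{KR_p^{α,β}} ≤ 1 }. -/

import Mathlib

open MeasureTheory ENNReal

noncomputable section

variable {X : Type*} [MeasurableSpace X]

/-- Couplings (transport plans) between two nonnegative measures. -/
def couplings (ρ₁ ρ₂ : Measure X) : Set (Measure (X × X)) :=
  {γ | γ.map Prod.fst = ρ₁ ∧ γ.map Prod.snd = ρ₂}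

/-- The transport cost of a plan for the cost `|x-y|^p`. -/
def transportCost [PseudoMetricSpace X] (p : ℝ) (γ : Measure (X × X)) : ℝ≥0∞ :=
  ∫⁻ z, ENNReal.ofReal (dist z.1 z.2 ^ p) ∂γ

/-- The `p`-Wasserstein cost `W_p` (no `1/p`-th power is taken); it is `∞` if
there is no coupling. -/
def W [PseudoMetricSpace X] (p : ℝ) (ρ₁ ρ₂ : Measure X) : ℝ≥0∞ :=
  ⨅ (γ : Measure (X × X)) (_ : γ ∈ couplings ρ₁ ρ₂), transportCost p γ

/-- Positive part `μ⁺` of the Hahn-Jordan decomposition. -/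
def pos (μ : SignedMeasure X) : Measure X := μ.toJordanDecomposition.posPart

/-- Negative part `μ⁻` of the Hahn-Jordan decomposition. -/
def neg (μ : SignedMeasure X) : Measure X := μ.toJordanDecomposition.negPart

/-- Total variation `|μ|(Ω)`. -/
def tv (μ : SignedMeasure X) : ℝ≥0∞ := μ.totalVariation Set.univ

/-- The generalized Kantorovich-Rubinstein norm `‖μ‖_{KR_p^{α,β}}`. -/
def KRnorm [PseudoMetricSpace X] (p α β : ℝ) (μ : SignedMeasure X) : ℝ≥0∞ :=
  ⨅ (ν : SignedMeasure X) (_ : ν Set.univ = 0),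
    W p (pos ν) (neg ν) + ENNReal.ofReal (β / 2) * tv ν + ENNReal.ofReal α * tv (μ - ν)

/-- Dirac delta `δ_x` as a signed measure. -/
def sDirac (x : X) : SignedMeasure X := (Measure.dirac x).toSignedMeasure

/-- Duality pairing `∫ q dμ` of a continuous function against a signed measure. -/
def pairing [TopologicalSpace X] (q : C(X, ℝ)) (μ : SignedMeasure X) : ℝ :=
  ∫ x, q x ∂(pos μ) - ∫ x, q x ∂(neg μ)

/-- The weak* topology on signed measures, induced by testing against `C₀` functions. -/
def weakStar (X : Type*) [MeasurableSpace X] [TopologicalSpace X] :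
    TopologicalSpace (SignedMeasure X) :=
  TopologicalSpace.induced
    (fun μ => fun f : ZeroAtInftyContinuousMap X ℝ =>
      ∫ x, f x ∂(pos μ) - ∫ x, f x ∂(neg μ))
    Pi.topologicalSpace

/-- Support of a nonnegative measure. -/
def msupport [TopologicalSpace X] (μ : Measure X) : Set X :=
  {x | ∀ U : Set X, IsOpen U → x ∈ U → μ U ≠ 0}

end

section SignedIntegral

variable {X : Type*} [MeasurableSpace X]

instance (μ : SignedMeasure X) : IsFiniteMeasure (pos μ) :=
  μ.toJordanDecomposition.posPart_finite

instance (μ : SignedMeasure X) : IsFiniteMeasure (neg μ) :=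
  μ.toJordanDecomposition.negPart_finite

/-- The integral of a function against a signed measure, via its Jordan decomposition. -/
noncomputable def signedIntegral (f : X → ℝ) (μ : SignedMeasure X) : ℝ :=
  ∫ x, f x ∂(pos μ) - ∫ x, f x ∂(neg μ)

lemma pos_sub_neg (μ : SignedMeasure X) :
    (pos μ).toSignedMeasure - (neg μ).toSignedMeasure = μ :=
  μ.toSignedMeasure_toJordanDecomposition

lemma apply_eq_pos_sub_neg (μ : SignedMeasure X) {E : Set X} (hE : MeasurableSet E) :
    μ E = (pos μ).real E - (neg μ).real E :=
  μ.apply_eq_posPart_real_sub_negPart_real hE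

lemma tv_eq_pos_add_neg (μ : SignedMeasure X) :
    tv μ = pos μ Set.univ + neg μ Set.univ := rfl

lemma tv_ne_top (μ : SignedMeasure X) : tv μ ≠ ⊤ := by
  simp [tv_eq_pos_add_neg]

lemma toReal_tv (μ : SignedMeasure X) :
    (tv μ).toReal = (pos μ).real Set.univ + (neg μ).real Set.univ := by
  rw [tv_eq_pos_add_neg, ENNReal.toReal_add (measure_ne_top _ _) (measure_ne_top _ _)]
  rfl

lemma abs_apply_le_tv (μ : SignedMeasure X) {E : Set X} (hE : MeasurableSet E) :
    |μ E| ≤ (tv μ).toReal := by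
  rw [apply_eq_pos_sub_neg μ hE, toReal_tv, abs_le]
  have h₁ : (pos μ).real E ≤ (pos μ).real Set.univ := measureReal_mono (Set.subset_univ E)
  have h₂ : (neg μ).real E ≤ (neg μ).real Set.univ := measureReal_mono (Set.subset_univ E)
  have h₃ : 0 ≤ (pos μ).real E := measureReal_nonneg
  have h₄ : 0 ≤ (neg μ).real E := measureReal_nonneg
  constructor <;> linarith

variable {f : X → ℝ} {K : ℝ}

lemma integrable_of_measurable_of_abs_le (hf : Measurable f) (hK : ∀ z, |f z| ≤ K)
    (ρ : Measure X) [IsFiniteMeasure ρ] : Integrable f ρ :=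
  Integrable.of_bound hf.aestronglyMeasurable K (Filter.Eventually.of_forall hK)

lemma signedIntegral_toSignedMeasure_sub (hf : Measurable f) (hK : ∀ z, |f z| ≤ K)
    (ρ₁ ρ₂ : Measure X) [IsFiniteMeasure ρ₁] [IsFiniteMeasure ρ₂] :
    signedIntegral f (ρ₁.toSignedMeasure - ρ₂.toSignedMeasure) =
      ∫ x, f x ∂ρ₁ - ∫ x, f x ∂ρ₂ := by
  have hint := integrable_of_measurable_of_abs_le hf hK
  set μ := ρ₁.toSignedMeasure - ρ₂.toSignedMeasure with hμ
  have h : pos μ + ρ₂ = ρ₁ + neg μ := by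
    rw [← Measure.toSignedMeasure_eq_toSignedMeasure_iff, Measure.toSignedMeasure_add,
      Measure.toSignedMeasure_add, ← sub_eq_sub_iff_add_eq_add, pos_sub_neg]
  have h' := congrArg (fun ρ => ∫ x, f x ∂ρ) h
  simp only [integral_add_measure (hint _) (hint _)] at h'
  unfold signedIntegral
  linarith

lemma signedIntegral_add (hf : Measurable f) (hK : ∀ z, |f z| ≤ K) (μ ν : SignedMeasure X) :
    signedIntegral f (μ + ν) = signedIntegral f μ + signedIntegral f ν := by
  have hint := integrable_of_measurable_of_abs_le hf hK
  have h : μ + ν =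
      (pos μ + pos ν).toSignedMeasure - (neg μ + neg ν).toSignedMeasure := by
    rw [Measure.toSignedMeasure_add, Measure.toSignedMeasure_add, add_sub_add_comm,
      pos_sub_neg, pos_sub_neg]
  rw [h, signedIntegral_toSignedMeasure_sub hf hK, integral_add_measure (hint _) (hint _),
    integral_add_measure (hint _) (hint _)]
  unfold signedIntegral
  ring

lemma signedIntegral_smul (f : X → ℝ) {c : ℝ} (hc : 0 ≤ c) (μ : SignedMeasure X) :
    signedIntegral f (c • μ) = c * signedIntegral f μ := by
  lift c to NNReal using hc
  have h : ((c : ℝ) • μ) = c • μ := rfl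
  simp only [signedIntegral, pos, neg, h, SignedMeasure.toJordanDecomposition_smul,
    JordanDecomposition.smul_posPart, JordanDecomposition.smul_negPart,
    integral_smul_nnreal_measure]
  rw [← smul_sub, NNReal.smul_def, smul_eq_mul]

lemma signedIntegral_le_tv (hK : ∀ z, |f z| ≤ K) (μ : SignedMeasure X) :
    signedIntegral f μ ≤ K * (tv μ).toReal := by
  have h (ρ : Measure X) [IsFiniteMeasure ρ] : |∫ x, f x ∂ρ| ≤ K * ρ.real Set.univ :=
    norm_integral_le_of_norm_le_const (f := f) (μ := ρ) (Filter.Eventually.of_forall hK)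
  have h₁ := abs_le.1 (h (pos μ))
  have h₂ := abs_le.1 (h (neg μ))
  rw [toReal_tv]
  unfold signedIntegral
  linarith

end SignedIntegral

section Dipole

variable {X : Type*} [MeasurableSpace X]

lemma pos_neg_smul_dipole [MeasurableSingletonClass X] {x y : X} (hxy : x ≠ y)
    (c : NNReal) :
    pos (c • (sDirac x - sDirac y)) = c • Measure.dirac x ∧
      neg (c • (sDirac x - sDirac y)) = c • Measure.dirac y := by
  let j : JordanDecomposition X :=
    { posPart := c • Measure.dirac x
      negPart := c • Measure.dirac y
      mutuallySingular := by
        refine ⟨{y}, measurableSet_singleton y, ?_, ?_⟩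
        · simp [hxy]
        · simp }
  have h : c • (sDirac x - sDirac y) = j.toSignedMeasure := by
    simp [j, JordanDecomposition.toSignedMeasure, Measure.toSignedMeasure_smul, smul_sub, sDirac]
  have hj := SignedMeasure.toJordanDecomposition_eq h
  simp [pos, neg, hj, j]

lemma KRnorm_smul_dipole_le [PseudoMetricSpace X] [MeasurableSingletonClass X]
    (p α : ℝ) {β : ℝ} (hβ : 0 ≤ β) {x y : X} (hxy : x ≠ y) {c : ℝ} (hc : 0 ≤ c) :
    KRnorm p α β (c • (sDirac x - sDirac y)) ≤
      ENNReal.ofReal (c * (β + dist x y ^ p)) := by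
  lift c to NNReal using hc
  obtain ⟨hpos, hneg⟩ := pos_neg_smul_dipole hxy c
  change KRnorm p α β (c • (sDirac x - sDirac y)) ≤ _
  refine (iInf₂_le (c • (sDirac x - sDirac y)) ?_).trans ?_
  · simp [sDirac]
  · have hW : W p (pos (c • (sDirac x - sDirac y))) (neg (c • (sDirac x - sDirac y))) ≤
        c * ENNReal.ofReal (dist x y ^ p) := by
      refine (iInf₂_le (c • Measure.dirac (x, y)) ?_).trans ?_
      · rw [hpos, hneg]
        constructor
        · rw [Measure.map_smul, Measure.map_dirac' measurable_fst]
        · rw [Measure.map_smul, Measure.map_dirac' measurable_snd]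
      · rw [transportCost, lintegral_smul_measure, lintegral_dirac]
        rfl
    have htv : tv (c • (sDirac x - sDirac y)) = c * 2 := by
      rw [tv_eq_pos_add_neg, hpos, hneg]
      simp [← mul_two]
    have h0 : tv (0 : SignedMeasure X) = 0 := by
      simp [tv, SignedMeasure.totalVariation_zero]
    rw [sub_self, htv, h0, mul_zero, add_zero]
    refine (add_le_add_left hW _).trans_eq ?_
    have hd : 0 ≤ dist x y ^ p := by positivity
    rw [← ENNReal.ofReal_coe_nnreal, ← ENNReal.ofReal_ofNat 2,
      ← ENNReal.ofReal_mul c.coe_nonneg, ← ENNReal.ofReal_mul c.coe_nonneg,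
      ← ENNReal.ofReal_mul (by positivity), ← ENNReal.ofReal_add (by positivity) (by positivity)]
    congr 1
    ring

end Dipole

section Duality

variable {X : Type*} [MeasurableSpace X] [PseudoMetricSpace X]

/-- A nearly optimal competitor in the definition of `KRnorm`, presented through its plan. -/
lemma exists_plan_of_KRnorm_lt {p α β C : ℝ} (hα : 0 ≤ α) (hβ : 0 ≤ β) {μ : SignedMeasure X}
    (h : KRnorm p α β μ < ENNReal.ofReal C) :
    ∃ (ν : SignedMeasure X) (γ : Measure (X × X)), IsFiniteMeasure γ ∧
      γ ∈ couplings (pos ν) (neg ν) ∧ transportCost p γ ≠ ⊤ ∧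
      (transportCost p γ).toReal + β * γ.real Set.univ + α * (tv (μ - ν)).toReal < C := by
  obtain ⟨ν, h⟩ := iInf_lt_iff.1 h
  obtain ⟨-, h⟩ := iInf_lt_iff.1 h
  rw [add_assoc] at h
  simp only [W, ENNReal.iInf_add] at h
  obtain ⟨γ, h⟩ := iInf_lt_iff.1 h
  obtain ⟨hγ, h⟩ := iInf_lt_iff.1 h
  have hfst : γ Set.univ = pos ν Set.univ := by
    rw [← hγ.1, Measure.map_apply measurable_fst MeasurableSet.univ, Set.preimage_univ]
  have hsnd : γ Set.univ = neg ν Set.univ := by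
    rw [← hγ.2, Measure.map_apply measurable_snd MeasurableSet.univ, Set.preimage_univ]
  have hfin : IsFiniteMeasure γ := ⟨by rw [hfst]; exact measure_lt_top _ _⟩
  have hcost : transportCost p γ ≠ ⊤ := fun htop => by simp [htop] at h
  refine ⟨ν, γ, hfin, hγ, hcost, ?_⟩
  have h₁ := mul_ne_top (ofReal_ne_top (r := β / 2)) (tv_ne_top ν)
  have h₂ := mul_ne_top (ofReal_ne_top (r := α)) (tv_ne_top (μ - ν))
  have h' := (ENNReal.lt_ofReal_iff_toReal_lt (add_ne_top.2 ⟨hcost, add_ne_top.2 ⟨h₁, h₂⟩⟩)).1 h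
  rw [ENNReal.toReal_add hcost (add_ne_top.2 ⟨h₁, h₂⟩), ENNReal.toReal_add h₁ h₂,
    ENNReal.toReal_mul, ENNReal.toReal_mul, ENNReal.toReal_ofReal (by positivity),
    ENNReal.toReal_ofReal hα, toReal_tv ν, measureReal_def, measureReal_def, ← hfst,
    ← hsnd, ← measureReal_def] at h'
  linarith

variable [OpensMeasurableSpace X] [SecondCountableTopology X]

lemma integrable_dist_rpow {p : ℝ} {γ : Measure (X × X)} (h : transportCost p γ ≠ ⊤) :
    Integrable (fun z : X × X => dist z.1 z.2 ^ p) γ := by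
  refine ⟨(measurable_dist.pow_const p).aestronglyMeasurable, ?_⟩
  rw [hasFiniteIntegral_iff_ofReal (Filter.Eventually.of_forall fun z => by positivity)]
  exact lt_top_iff_ne_top.2 h

lemma integral_dist_rpow (p : ℝ) (γ : Measure (X × X)) :
    ∫ z : X × X, dist z.1 z.2 ^ p ∂γ = (transportCost p γ).toReal :=
  integral_eq_lintegral_of_nonneg_ae (Filter.Eventually.of_forall fun z => by positivity)
    (measurable_dist.pow_const p).aestronglyMeasurable

/-- Quantitative weak duality: a potential with slack `δ` off the diagonal pair `(x, y)` forces
nearly optimal plans to concentrate at `(x, y)`. -/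
lemma exists_plan_concentrated [MeasurableSingletonClass X] {p α β K δ ε : ℝ} (hα : 0 ≤ α)
    (hβ : 0 ≤ β) (hε : 0 < ε) {f : X → ℝ} (hf : Measurable f) (hK : ∀ z, |f z| ≤ K) {x y : X}
    (hslack : ∀ z : X × X, f z.1 - f z.2 + ({(x, y)}ᶜ : Set (X × X)).indicator (fun _ => δ) z ≤
      β + dist z.1 z.2 ^ p)
    {μ : SignedMeasure X} (hμ : KRnorm p α β μ ≤ 1) :
    ∃ (γ : Measure (X × X)) (t : ℝ), IsFiniteMeasure γ ∧ 0 ≤ t ∧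
      (∀ E, MeasurableSet E →
        |μ E - (γ.real (Prod.fst ⁻¹' E) - γ.real (Prod.snd ⁻¹' E))| ≤ t) ∧
      signedIntegral f μ + δ * γ.real {(x, y)}ᶜ + (α - K) * t ≤ 1 + ε := by
  have hlt : KRnorm p α β μ < ENNReal.ofReal (1 + ε) :=
    hμ.trans_lt (by rw [ENNReal.one_lt_ofReal]; linarith)
  obtain ⟨ν, γ, hfin, hγ, hcost, h⟩ := exists_plan_of_KRnorm_lt hα hβ hlt
  refine ⟨γ, (tv (μ - ν)).toReal, hfin, ENNReal.toReal_nonneg, fun E hE => ?_, ?_⟩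
  · have hE' := abs_apply_le_tv (μ - ν) hE
    rwa [_root_.sub_apply, apply_eq_pos_sub_neg ν hE, ← hγ.1, ← hγ.2,
      map_measureReal_apply measurable_fst hE, map_measureReal_apply measurable_snd hE] at hE'
  · have hsum : signedIntegral f μ = signedIntegral f ν + signedIntegral f (μ - ν) := by
      rw [← signedIntegral_add hf hK, add_sub_cancel]
    have hrest := signedIntegral_le_tv hK (μ - ν)
    have hf₁ : Integrable (fun z : X × X => f z.1) γ :=
      integrable_of_measurable_of_abs_le (hf.comp measurable_fst) (fun z => hK z.1) γ
    have hf₂ : Integrable (fun z : X × X => f z.2) γ :=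
      integrable_of_measurable_of_abs_le (hf.comp measurable_snd) (fun z => hK z.2) γ
    have hS : MeasurableSet ({(x, y)}ᶜ : Set (X × X)) := (measurableSet_singleton _).compl
    have hind : Integrable (({(x, y)}ᶜ : Set (X × X)).indicator (fun _ => δ)) γ :=
      (integrable_const δ).indicator hS
    have hν : signedIntegral f ν = ∫ z : X × X, (f z.1 - f z.2) ∂γ := by
      rw [integral_sub hf₁ hf₂, signedIntegral, ← hγ.1, ← hγ.2,
        integral_map measurable_fst.aemeasurable hf.aestronglyMeasurable,
        integral_map measurable_snd.aemeasurable hf.aestronglyMeasurable]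
    have hmono := integral_mono ((hf₁.sub hf₂).add hind)
      ((integrable_const β).add (integrable_dist_rpow hcost)) hslack
    rw [integral_add' (hf₁.sub hf₂) hind, integral_add' (integrable_const β)
      (integrable_dist_rpow hcost), integral_dist_rpow, integral_const, smul_eq_mul,
      integral_indicator_const δ hS, smul_eq_mul] at hmono
    simp only [Pi.sub_apply] at hmono
    rw [← hν] at hmono
    linarith

end Duality

section Potential

variable {X : Type*} [MetricSpace X]

lemma dist_rpow_triangle {p : ℝ} (hp0 : 0 ≤ p) (hp1 : p ≤ 1) (a b c : X) :
    dist a c ^ p ≤ dist a b ^ p + dist b c ^ p :=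
  (Real.rpow_le_rpow dist_nonneg (dist_triangle a b c) hp0).trans
    (Real.rpow_add_le_add_rpow dist_nonneg dist_nonneg hp0 hp1)

open Classical in
/-- A potential that is tight for the dipole `(x, y)` and has slack for every other pair. -/
noncomputable def dipolePotential (p β : ℝ) (x y z : X) : ℝ :=
  (dist y z ^ p - dist x z ^ p) / 2 +
    β / 2 * ((if z = x then 1 else 0) - if z = y then 1 else 0)

variable {p β : ℝ} {x y : X}

lemma measurable_dipolePotential [MeasurableSpace X] [OpensMeasurableSpace X]
    (p β : ℝ) (x y : X) : Measurable (dipolePotential p β x y) := by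
  have h (a : X) : Measurable fun z : X => dist a z ^ p :=
    (continuous_const.dist continuous_id).measurable.pow_const p
  have h' (a : X) : MeasurableSet {z : X | z = a} := measurableSet_singleton a
  exact (((h y).sub (h x)).div_const 2).add
    (((Measurable.ite (h' x) measurable_const measurable_const).sub
      (Measurable.ite (h' y) measurable_const measurable_const)).const_mul (β / 2))

lemma abs_dipolePotential_le (hp0 : 0 ≤ p) (hp1 : p ≤ 1) (hβ : 0 ≤ β) (z : X) :
    |dipolePotential p β x y z| ≤ (β + dist x y ^ p) / 2 := by
  have h₁ := dist_rpow_triangle hp0 hp1 x y z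
  have h₂ := dist_rpow_triangle hp0 hp1 y x z
  rw [dist_comm y x] at h₂
  unfold dipolePotential
  rw [abs_le]
  split_ifs <;> constructor <;> linarith

lemma dipolePotential_sub (hp0 : 0 < p) (hxy : x ≠ y) :
    dipolePotential p β x y x - dipolePotential p β x y y = β + dist x y ^ p := by
  simp [dipolePotential, hxy, hxy.symm, Real.zero_rpow hp0.ne', dist_comm y x]
  ring

lemma dipolePotential_slack (hp0 : 0 ≤ p) (hp1 : p ≤ 1) (hβ : 0 ≤ β) (hxy : x ≠ y) (z : X × X) :
    dipolePotential p β x y z.1 - dipolePotential p β x y z.2 +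
      ({(x, y)}ᶜ : Set (X × X)).indicator (fun _ => β / 2) z ≤ β + dist z.1 z.2 ^ p := by
  classical
  obtain ⟨a, b⟩ := z
  have h₁ := dist_rpow_triangle hp0 hp1 y b a
  have h₂ := dist_rpow_triangle hp0 hp1 x a b
  rw [dist_comm b a] at h₁
  simp only [dipolePotential, Set.indicator, Set.mem_compl_iff, Set.mem_singleton_iff,
    Prod.mk.injEq]
  by_cases hax : a = x <;> by_cases hay : a = y <;> by_cases hbx : b = x <;>
    by_cases hby : b = y <;> simp_all <;> linarith

lemma signedIntegral_dipolePotential_smul_dipole [MeasurableSpace X]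
    [OpensMeasurableSpace X] (hp0 : 0 < p) (hp1 : p ≤ 1) (hβ : 0 ≤ β)
    (hxy : x ≠ y) (c : ℝ) (hc : 0 ≤ c) :
    signedIntegral (dipolePotential p β x y) (c • (sDirac x - sDirac y)) =
      c * (β + dist x y ^ p) := by
  rw [signedIntegral_smul _ hc, sDirac, sDirac,
    signedIntegral_toSignedMeasure_sub (measurable_dipolePotential p β x y)
      (abs_dipolePotential_le hp0.le hp1 hβ),
    integral_dirac' _ _ (measurable_dipolePotential p β x y).stronglyMeasurable,
    integral_dirac' _ _ (measurable_dipolePotential p β x y).stronglyMeasurable,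
    dipolePotential_sub hp0 hxy]

end Potential

section Uniqueness

variable {X : Type*} [MeasurableSpace X]

lemma smul_dipole_apply (c : ℝ) (x y : X) {E : Set X} (hE : MeasurableSet E) :
    (c • (sDirac x - sDirac y)) E =
      c * ((Measure.dirac x).real E - (Measure.dirac y).real E) := by
  rw [_root_.smul_apply, smul_eq_mul, sDirac, sDirac, Measure.toSignedMeasure_sub_apply hE]

lemma abs_marginals_sub_dipole_le [MeasurableSingletonClass X] (γ : Measure (X × X))
    [IsFiniteMeasure γ] (x y : X) {E : Set X} (hE : MeasurableSet E) :
    |γ.real (Prod.fst ⁻¹' E) - γ.real (Prod.snd ⁻¹' E) -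
      γ.real {(x, y)} * ((Measure.dirac x).real E - (Measure.dirac y).real E)| ≤
      γ.real {(x, y)}ᶜ := by
  have key (S : Set (X × X)) (hS : MeasurableSet S) :
      0 ≤ γ.real S - γ.real {(x, y)} * S.indicator 1 (x, y) ∧
        γ.real S - γ.real {(x, y)} * S.indicator 1 (x, y) ≤ γ.real {(x, y)}ᶜ := by
    by_cases hm : (x, y) ∈ S
    · have hsub : ({(x, y)} : Set (X × X)) ⊆ S := Set.singleton_subset_iff.2 hm
      have hd := measureReal_sdiff (μ := γ) hsub (measurableSet_singleton _)
      have hle : γ.real (S \ {(x, y)}) ≤ γ.real {(x, y)}ᶜ :=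
        measureReal_mono fun z hz => hz.2
      have h0 : 0 ≤ γ.real (S \ {(x, y)}) := measureReal_nonneg
      simp only [Set.indicator_of_mem hm, Pi.one_apply, mul_one]
      exact ⟨by linarith, by linarith⟩
    · have hle : γ.real S ≤ γ.real {(x, y)}ᶜ :=
        measureReal_mono (Set.subset_compl_singleton_iff.2 hm)
      simp only [Set.indicator_of_notMem hm, mul_zero, sub_zero]
      exact ⟨measureReal_nonneg, hle⟩
  have h₁ := key _ (measurable_fst hE)
  have h₂ := key _ (measurable_snd hE)
  have hx : (Measure.dirac x).real E = (Prod.fst ⁻¹' E).indicator 1 (x, y) := by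
    by_cases h : x ∈ E <;> simp [measureReal_def, Measure.dirac_apply' _ hE, h]
  have hy : (Measure.dirac y).real E = (Prod.snd ⁻¹' E).indicator 1 (x, y) := by
    by_cases h : y ∈ E <;> simp [measureReal_def, Measure.dirac_apply' _ hE, h]
  rw [hx, hy, abs_le]
  constructor <;> linarith

/-- A signed measure arbitrarily close to multiples of a dipole is a multiple of that dipole. -/
lemma eq_smul_dipole_of_forall_close [MeasurableSingletonClass X] {x y : X} (hxy : x ≠ y)
    {μ : SignedMeasure X}
    (h : ∀ ε > 0, ∃ m : ℝ, ∀ E, MeasurableSet E →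
      |μ E - m * ((Measure.dirac x).real E - (Measure.dirac y).real E)| ≤ ε) :
    μ = μ {x} • (sDirac x - sDirac y) := by
  refine VectorMeasure.ext fun E hE => ?_
  rw [smul_dipole_apply _ _ _ hE]
  set d := (Measure.dirac x).real E - (Measure.dirac y).real E with hd
  have hd1 : |d| ≤ 1 := by
    rw [hd]
    by_cases hx : x ∈ E <;> by_cases hy : y ∈ E <;>
      simp [measureReal_def, Measure.dirac_apply' _ hE, hx, hy]
  refine sub_eq_zero.1 (abs_nonpos_iff.1 (le_of_forall_pos_le_add fun ε hε => ?_))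
  obtain ⟨m, hm⟩ := h (ε / 2) (by positivity)
  have h₁ := hm E hE
  have h₂ := hm {x} (measurableSet_singleton x)
  have hx : (Measure.dirac x).real {x} - (Measure.dirac y).real {x} = 1 := by
    simp [measureReal_def, hxy.symm]
  rw [hx, mul_one] at h₂
  calc |μ E - μ {x} * d| = |(μ E - m * d) - (μ {x} - m) * d| := by ring_nf
    _ ≤ |μ E - m * d| + |(μ {x} - m) * d| := abs_sub _ _
    _ ≤ ε / 2 + ε / 2 * 1 := by
      rw [abs_mul]
      gcongr
    _ = 0 + ε := by ring

end Uniqueness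

section KRBall

variable {X : Type*} [MeasurableSpace X] [MetricSpace X] [OpensMeasurableSpace X]
  [SecondCountableTopology X] {p α β : ℝ} {x y : X}

lemma signedIntegral_dipolePotential_le_one (hp0 : 0 < p) (hp1 : p ≤ 1) (hα : 0 < α)
    (hβ : 0 < β) (hxy : x ≠ y) (hd : dist x y ^ p < 2 * α - β) {μ : SignedMeasure X}
    (hμ : KRnorm p α β μ ≤ 1) : signedIntegral (dipolePotential p β x y) μ ≤ 1 := by
  refine le_of_forall_pos_le_add fun ε hε => ?_
  obtain ⟨γ, t, hfin, ht, -, h⟩ := exists_plan_concentrated hα.le hβ.le hε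
    (measurable_dipolePotential p β x y) (abs_dipolePotential_le hp0.le hp1 hβ.le)
    (dipolePotential_slack hp0.le hp1 hβ.le hxy) hμ
  have h₁ : 0 ≤ β / 2 * γ.real {(x, y)}ᶜ := by positivity
  have h₂ : 0 ≤ (α - (β + dist x y ^ p) / 2) * t := mul_nonneg (by linarith) ht
  linarith

lemma eq_dipole_of_signedIntegral_dipolePotential_eq_one (hp0 : 0 < p) (hp1 : p ≤ 1) (hα : 0 < α)
    (hβ : 0 < β) (hxy : x ≠ y) (hd : dist x y ^ p < 2 * α - β) {μ : SignedMeasure X}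
    (hμ : KRnorm p α β μ ≤ 1) (hone : signedIntegral (dipolePotential p β x y) μ = 1) :
    μ = (β + dist x y ^ p)⁻¹ • (sDirac x - sDirac y) := by
  have hgap : 0 < α - (β + dist x y ^ p) / 2 := by linarith
  have hclose : μ = μ {x} • (sDirac x - sDirac y) := by
    refine eq_smul_dipole_of_forall_close hxy fun ε hε => ?_
    set r := min (β / 2) (α - (β + dist x y ^ p) / 2) with hr
    have hr0 : 0 < r := lt_min (by positivity) hgap
    obtain ⟨γ, t, hfin, ht, hγ, h⟩ := exists_plan_concentrated hα.le hβ.le (mul_pos hr0 hε)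
      (measurable_dipolePotential p β x y) (abs_dipolePotential_le hp0.le hp1 hβ.le)
      (dipolePotential_slack hp0.le hp1 hβ.le hxy) hμ
    refine ⟨γ.real {(x, y)}, fun E hE => ?_⟩
    have h₁ : r * γ.real {(x, y)}ᶜ ≤ β / 2 * γ.real {(x, y)}ᶜ := by
      gcongr
      exact min_le_left _ _
    have h₂ : r * t ≤ (α - (β + dist x y ^ p) / 2) * t := by
      gcongr
      exact min_le_right _ _
    have hsmall : γ.real {(x, y)}ᶜ + t ≤ ε :=
      le_of_mul_le_mul_left (by linarith) hr0
    have h₃ := abs_add_le _ _ |>.trans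
      (add_le_add (hγ E hE) (abs_marginals_sub_dipole_le γ x y hE))
    rw [sub_add_sub_cancel] at h₃
    linarith
  rw [hclose] at hone
  have hD : 0 < β + dist x y ^ p := by positivity
  have hm : μ {x} = (β + dist x y ^ p)⁻¹ := by
    rcases le_total 0 (μ {x}) with hm | hm
    · rw [signedIntegral_dipolePotential_smul_dipole hp0 hp1 hβ.le hxy _ hm] at hone
      exact eq_inv_of_mul_eq_one_left hone
    · have hneg := signedIntegral_add (measurable_dipolePotential p β x y)
        (abs_dipolePotential_le hp0.le hp1 hβ.le) (μ {x} • (sDirac x - sDirac y))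
        ((-μ {x}) • (sDirac x - sDirac y))
      rw [hone, signedIntegral_dipolePotential_smul_dipole hp0 hp1 hβ.le hxy _ (by linarith),
        ← add_smul, add_neg_cancel,
        signedIntegral_dipolePotential_smul_dipole hp0 hp1 hβ.le hxy _ le_rfl] at hneg
      have := mul_nonneg (neg_nonneg.2 hm) hD.le
      linarith
  rw [hclose, hm]

/-- In a separable metric space, rescaled dipoles are extreme points of the KR unit ball. -/
theorem smul_dipole_mem_extremePoints (hp0 : 0 < p) (hp1 : p ≤ 1) (hα : 0 < α) (hβ : 0 < β)
    (hxy : x ≠ y) (hd : dist x y ^ p < 2 * α - β) :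
    (β + dist x y ^ p)⁻¹ • (sDirac x - sDirac y) ∈
      Set.extremePoints ℝ {μ : SignedMeasure X | KRnorm p α β μ ≤ 1} := by
  have hD : 0 < β + dist x y ^ p := by positivity
  rw [mem_extremePoints]
  refine ⟨?_, fun v₁ hv₁ v₂ hv₂ hseg => ?_⟩
  · refine (KRnorm_smul_dipole_le p α hβ.le hxy (inv_nonneg.2 hD.le)).trans_eq ?_
    rw [inv_mul_cancel₀ hD.ne', ENNReal.ofReal_one]
  · obtain ⟨a, b, ha, hb, hab, h⟩ := hseg
    have h₁ := signedIntegral_dipolePotential_le_one hp0 hp1 hα hβ hxy hd hv₁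
    have h₂ := signedIntegral_dipolePotential_le_one hp0 hp1 hα hβ hxy hd hv₂
    have hI := congrArg (signedIntegral (dipolePotential p β x y)) h
    rw [signedIntegral_add (measurable_dipolePotential p β x y)
      (abs_dipolePotential_le hp0.le hp1 hβ.le), signedIntegral_smul _ ha.le,
      signedIntegral_smul _ hb.le, signedIntegral_dipolePotential_smul_dipole hp0 hp1 hβ.le hxy _
        (inv_nonneg.2 hD.le), inv_mul_cancel₀ hD.ne'] at hI
    exact ⟨eq_dipole_of_signedIntegral_dipolePotential_eq_one hp0 hp1 hα hβ hxy hd hv₁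
        (by nlinarith),
      eq_dipole_of_signedIntegral_dipolePotential_eq_one hp0 hp1 hα hβ hxy hd hv₂
        (by nlinarith)⟩

end KRBall

/-- rescaled dipoles with `0 < |x-y|^p < 2α - β` are extremal points
of the KR unit ball. -/
theorem dipole_extremePoint_KRball {n : ℕ} (Ω : Set (EuclideanSpace ℝ (Fin n)))
    (hΩ : Convex ℝ Ω) (p α β : ℝ) (hp0 : 0 < p) (hp1 : p ≤ 1) (hα : 0 < α) (hβ : 0 < β)
    (x y : ↥Ω) (hd0 : 0 < dist x y ^ p) (hd1 : dist x y ^ p < 2 * α - β) :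
    (β + dist x y ^ p)⁻¹ • (sDirac x - sDirac y) ∈
      Set.extremePoints ℝ {μ : SignedMeasure ↥Ω | KRnorm p α β μ ≤ 1} := by
  have hxy : x ≠ y := by
    rintro rfl
    simp [Real.zero_rpow hp0.ne'] at hd0
  exact smul_dipole_mem_extremePoints hp0 hp1 hα hβ hxy hd1
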